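/- There exists a constant C₄, depending only on d and C₀, such that for every x ∈ ℝ² and every r > 0 one has μ(B(x, r)) ≤ C₄ · r^{2−d}, where B(x,r) is the Euclidean disc of center x and radius r. -/

import Mathlib

open MeasureTheory Metric Set
open scoped ENNReal Classical

noncomputable section

/-- The half-open axis-parallel square with center `c` and side length `L`,
i.e. `[c.re - L/2, c.re + L/2) × [c.im - L/2, c.im + L/2)` in `ℝ² = ℂ`. -/
def square (c : ℂ) (L : ℝ) : Set ℂ :=
  {w : ℂ | w.re ∈ Set.Ico (c.re - L / 2) (c.re + L / 2) ∧
    w.im ∈ Set.Ico (c.im - L / 2) (c.im + L / 2)}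

/-- `c` is the center of a dyadic square of side length `2 ^ k`,
i.e. of `2 ^ k • ([0,1)² + z)` for some `z ∈ ℤ²`. -/
def IsDyadicCenter (c : ℂ) (k : ℤ) : Prop :=
  ∃ a b : ℤ, c.re = 2 ^ k * ((a : ℝ) + 1 / 2) ∧ c.im = 2 ^ k * ((b : ℝ) + 1 / 2)

/-- A dyadic interval `[2^k a, 2^k (a + 1))` meeting a dyadic interval of larger generation `n`
is contained in it. -/
theorem dyadic_interval_nested {k n : ℤ} (hkn : k ≤ n) {a A : ℤ} {t : ℝ}
    (h₁ : (2 : ℝ) ^ k * a ≤ t) (h₂ : t < 2 ^ k * (a + 1))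
    (h₃ : (2 : ℝ) ^ n * A ≤ t) (h₄ : t < 2 ^ n * (A + 1)) :
    (2 : ℝ) ^ n * A ≤ 2 ^ k * a ∧ (2 : ℝ) ^ k * (a + 1) ≤ 2 ^ n * (A + 1) := by
  obtain ⟨p, rfl⟩ : ∃ p : ℕ, n = k + p := ⟨(n - k).toNat, by omega⟩
  have hk : (0 : ℝ) < 2 ^ k := by positivity
  rw [zpow_add₀ two_ne_zero, zpow_natCast, mul_assoc] at *
  rw [mul_assoc] at *
  have hl : (2 : ℝ) ^ p * A < a + 1 := lt_of_mul_lt_mul_left (h₃.trans_lt h₂) hk.le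
  have hr : (a : ℝ) < 2 ^ p * (A + 1) := lt_of_mul_lt_mul_left (h₁.trans_lt h₄) hk.le
  have hl' : (2 : ℤ) ^ p * A < a + 1 := by exact_mod_cast hl
  have hr' : a < (2 : ℤ) ^ p * (A + 1) := by exact_mod_cast hr
  have hl'' : (2 : ℝ) ^ p * A ≤ a := by exact_mod_cast Int.lt_add_one_iff.mp hl'
  have hr'' : (a : ℝ) + 1 ≤ 2 ^ p * (A + 1) := by exact_mod_cast Int.add_one_le_iff.mpr hr'
  exact ⟨mul_le_mul_of_nonneg_left hl'' hk.le, mul_le_mul_of_nonneg_left hr'' hk.le⟩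

/-- The center of the dyadic square `2^k ([0,1)² + (a, b))`. -/
def dyadicCenter (k a b : ℤ) : ℂ :=
  ⟨2 ^ k * ((a : ℝ) + 1 / 2), 2 ^ k * ((b : ℝ) + 1 / 2)⟩

theorem isDyadicCenter_dyadicCenter (k a b : ℤ) : IsDyadicCenter (dyadicCenter k a b) k :=
  ⟨a, b, rfl, rfl⟩

theorem IsDyadicCenter.exists_eq {c : ℂ} {k : ℤ} (h : IsDyadicCenter c k) :
    ∃ a b : ℤ, c = dyadicCenter k a b := by
  obtain ⟨a, b, h₁, h₂⟩ := h
  exact ⟨a, b, Complex.ext h₁ h₂⟩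

theorem mem_square_dyadicCenter {k a b : ℤ} {w : ℂ} :
    w ∈ square (dyadicCenter k a b) (2 ^ k) ↔
      ((2 : ℝ) ^ k * a ≤ w.re ∧ w.re < 2 ^ k * (a + 1)) ∧
        ((2 : ℝ) ^ k * b ≤ w.im ∧ w.im < 2 ^ k * (b + 1)) := by
  simp only [square, dyadicCenter, mem_ofPred_eq, mem_Ico]
  ring_nf

/-- A dyadic square meeting a dyadic square of larger generation is contained in it. -/
theorem square_dyadicCenter_subset {k n a b A B : ℤ} (hkn : k ≤ n) {w : ℂ}
    (h : w ∈ square (dyadicCenter k a b) (2 ^ k))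
    (h' : w ∈ square (dyadicCenter n A B) (2 ^ n)) :
    square (dyadicCenter k a b) (2 ^ k) ⊆ square (dyadicCenter n A B) (2 ^ n) := by
  intro z hz
  rw [mem_square_dyadicCenter] at *
  have hre := dyadic_interval_nested hkn h.1.1 h.1.2 h'.1.1 h'.1.2
  have him := dyadic_interval_nested hkn h.2.1 h.2.2 h'.2.1 h'.2.2
  exact ⟨⟨hre.1.trans hz.1.1, hz.1.2.trans_le hre.2⟩,
    ⟨him.1.trans hz.2.1, hz.2.2.trans_le him.2⟩⟩

theorem exists_floor_offset {L s t : ℝ} (hL : 0 < L) (h : |t - s| < L) :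
    ∃ i ∈ Finset.Icc (-1 : ℤ) 1,
      L * ((⌊s / L⌋ + i : ℤ) : ℝ) ≤ t ∧ t < L * (((⌊s / L⌋ + i : ℤ) : ℝ) + 1) := by
  refine ⟨⌊t / L⌋ - ⌊s / L⌋, ?_, ?_⟩
  · have hst : t / L < s / L + 1 := by
      rw [div_add_one hL.ne']; gcongr; linarith [(abs_lt.mp h).2]
    have hts : s / L < t / L + 1 := by
      rw [div_add_one hL.ne']; gcongr; linarith [(abs_lt.mp h).1]
    have h₁ : ⌊t / L⌋ < ⌊s / L⌋ + 2 := by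
      rw [Int.floor_lt]; push_cast; linarith [Int.lt_floor_add_one (s / L)]
    have h₂ : ⌊s / L⌋ < ⌊t / L⌋ + 2 := by
      rw [Int.floor_lt]; push_cast; linarith [Int.lt_floor_add_one (t / L)]
    rw [Finset.mem_Icc]; omega
  · rw [add_sub_cancel, ← le_div_iff₀' hL, ← div_lt_iff₀' hL]
    exact ⟨Int.floor_le _, Int.lt_floor_add_one _⟩

theorem volume_square (c : ℂ) {L : ℝ} (hL : 0 ≤ L) :
    volume (square c L) = ENNReal.ofReal (L ^ 2) := by
  have h : square c L = Complex.measurableEquivRealProd ⁻¹'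
      (Ico (c.re - L / 2) (c.re + L / 2) ×ˢ Ico (c.im - L / 2) (c.im + L / 2)) := rfl
  rw [h, Complex.volume_preserving_equiv_real_prod.measure_preimage
    (measurableSet_Ico.prod measurableSet_Ico).nullMeasurableSet, Measure.volume_eq_prod,
    Measure.prod_prod, Real.volume_Ico, Real.volume_Ico, ← ENNReal.ofReal_mul (by linarith)]
  ring_nf

/-- If a ball of radius at most `L / 2` meets the square of side `L`, its center lies in the
square dilated by `4`. -/
theorem mem_square_four_mul {c x w : ℂ} {L r : ℝ} (hr : r ≤ L / 2)
    (hw : w ∈ square c L) (hwx : w ∈ ball x r) : x ∈ square c (4 * L) := by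
  rw [mem_ball, Complex.dist_eq] at hwx
  have hre := abs_lt.mp ((Complex.abs_re_le_norm (w - x)).trans_lt hwx)
  have him := abs_lt.mp ((Complex.abs_im_le_norm (w - x)).trans_lt hwx)
  simp only [Complex.sub_re, Complex.sub_im] at hre him
  obtain ⟨⟨h₁, h₂⟩, h₃, h₄⟩ := hw
  refine ⟨⟨?_, ?_⟩, ?_, ?_⟩ <;> linarith [hre.1, hre.2, him.1, him.2]

/-- The mass in a ball of one weighted dyadic square: either the square is small and it lies in one
of the nine dyadic squares of generation `n` around the ball, or it is large and its fourfold
dilation contains the center. -/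
theorem mass_square_inter_ball_le {d : ℝ} (hd0 : 0 < d) {c x : ℂ} {k n : ℤ} {r : ℝ}
    (hc : IsDyadicCenter c k) (hr : 0 < r) (hrn : r ≤ 2 ^ n) :
    ENNReal.ofReal (((2 : ℝ) ^ k) ^ (-d)) * volume (ball x r ∩ square c (2 ^ k)) ≤
      ENNReal.ofReal
        ((∑ p ∈ Finset.Icc (-1 : ℤ) 1 ×ˢ Finset.Icc (-1 : ℤ) 1,
          if square c (2 ^ k) ⊆
              square (dyadicCenter n (⌊x.re / 2 ^ n⌋ + p.1) (⌊x.im / 2 ^ n⌋ + p.2)) (2 ^ n)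
            then ((2 : ℝ) ^ k) ^ (2 - d) else 0) +
          if x ∈ square c (4 * 2 ^ k) then Real.pi * r ^ (2 - d) else 0) := by
  have hk : (0 : ℝ) < 2 ^ k := by positivity
  have hn : (0 : ℝ) < 2 ^ n := by positivity
  have hnonneg : ∀ p ∈ Finset.Icc (-1 : ℤ) 1 ×ˢ Finset.Icc (-1 : ℤ) 1,
      0 ≤ if square c (2 ^ k) ⊆
          square (dyadicCenter n (⌊x.re / 2 ^ n⌋ + p.1) (⌊x.im / 2 ^ n⌋ + p.2)) (2 ^ n)
        then ((2 : ℝ) ^ k) ^ (2 - d) else 0 := by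
    intro p _
    split_ifs <;> positivity
  rcases (ball x r ∩ square c (2 ^ k)).eq_empty_or_nonempty with he | ⟨w, hwx, hw⟩
  · simp [he]
  rcases le_or_gt k n with hkn | hkn
  · have hwx' := hwx
    rw [mem_ball, Complex.dist_eq] at hwx'
    obtain ⟨i, hi, hi'⟩ := exists_floor_offset hn (s := x.re) (t := w.re)
      ((Complex.abs_re_le_norm (w - x)).trans_lt (hwx'.trans_le hrn))
    obtain ⟨j, hj, hj'⟩ := exists_floor_offset hn (s := x.im) (t := w.im)
      ((Complex.abs_im_le_norm (w - x)).trans_lt (hwx'.trans_le hrn))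
    have hsub : square c (2 ^ k) ⊆
        square (dyadicCenter n (⌊x.re / 2 ^ n⌋ + i) (⌊x.im / 2 ^ n⌋ + j)) (2 ^ n) := by
      obtain ⟨a, b, rfl⟩ := hc.exists_eq
      exact square_dyadicCenter_subset hkn hw (mem_square_dyadicCenter.mpr ⟨hi', hj'⟩)
    have hsingle := Finset.single_le_sum hnonneg (Finset.mk_mem_product hi hj)
    rw [if_pos hsub] at hsingle
    calc _ ≤ ENNReal.ofReal (((2 : ℝ) ^ k) ^ (-d)) * ENNReal.ofReal (((2 : ℝ) ^ k) ^ 2) := by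
          rw [← volume_square c hk.le]
          gcongr
          exact inter_subset_right
      _ = ENNReal.ofReal (((2 : ℝ) ^ k) ^ (2 - d)) := by
          rw [← ENNReal.ofReal_mul (by positivity), ← Real.rpow_natCast _ 2,
            ← Real.rpow_add hk]
          congr 2
          push_cast
          ring
      _ ≤ _ := by
          refine ENNReal.ofReal_le_ofReal (hsingle.trans (le_add_of_nonneg_right ?_))
          split_ifs <;> positivity
  · have hnk : (2 : ℝ) ^ n ≤ 2 ^ k / 2 := by
      rw [le_div_iff₀ two_pos, ← zpow_add_one₀ two_ne_zero]
      exact zpow_le_zpow_right₀ one_le_two hkn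
    rw [if_pos (mem_square_four_mul (hrn.trans hnk) hw hwx)]
    calc _ ≤ ENNReal.ofReal (r ^ (-d)) * ENNReal.ofReal (Real.pi * r ^ 2) := by
          refine mul_le_mul' (ENNReal.ofReal_le_ofReal ?_)
            ((measure_mono inter_subset_left).trans_eq ?_)
          · exact Real.rpow_le_rpow_of_nonpos hr (by linarith) (by linarith)
          · rw [Complex.volume_ball, mul_comm Real.pi, ENNReal.ofReal_mul (by positivity),
              ENNReal.ofReal_pow hr.le]
            congr 1
            rw [← NNReal.coe_real_pi, ENNReal.ofReal_coe_nnreal]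
      _ = ENNReal.ofReal (Real.pi * r ^ (2 - d)) := by
          rw [← ENNReal.ofReal_mul (by positivity), ← Real.rpow_natCast _ 2, mul_left_comm,
            ← Real.rpow_add hr]
          congr 3
          push_cast
          ring
      _ ≤ _ := ENNReal.ofReal_le_ofReal (le_add_of_nonneg_left (Finset.sum_nonneg hnonneg))

/-- A sum with at most one nonzero term, all of whose nonzero terms equal `K`. -/
theorem sum_ite_le_of_subsingleton {ι : Type*} [Fintype ι] {p : ι → Prop}
    (hp : ∀ i j, p i → p j → i = j) {K : ℝ} (hK : 0 ≤ K) :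
    ∑ i, (if p i then K else 0) ≤ K := by
  have hcard : (Finset.univ.filter p).card ≤ 1 :=
    Finset.card_le_one.mpr fun i hi j hj ↦
      hp i j (Finset.mem_filter.mp hi).2 (Finset.mem_filter.mp hj).2
  rw [← Finset.sum_filter, Finset.sum_const, nsmul_eq_mul]
  exact mul_le_of_le_one_left hK (by exact_mod_cast hcard)

/-- the measure `μ = Σ_m ℓ(Q_m)^{-d} m₂|_{Q_m}` has `(2-d)`-growth:
`μ(B(x,r)) ≤ C₄ r^{2-d}` for every disc `B(x,r)`. -/
theorem statement2 (d : ℝ) (hd0 : 0 < d) (hd2 : d < 2) (C₀ : ℝ) (hC₀ : 1 ≤ C₀) :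
    ∃ C₄ : ℝ, 0 < C₄ ∧
      ∀ (M : ℕ) (c : Fin M → ℂ) (k : Fin M → ℤ),
        (∀ m, IsDyadicCenter (c m) (k m)) →
        (∀ m m', m ≠ m' →
          square (c m) (4 * 2 ^ (k m)) ∩ square (c m') (4 * 2 ^ (k m')) = ∅) →
        (∀ (c₀ : ℂ) (k₀ : ℤ), IsDyadicCenter c₀ k₀ →
          ∑ m, (if square (c m) (2 ^ (k m)) ⊆ square c₀ (2 ^ k₀)
                then ((2 : ℝ) ^ (k m)) ^ (2 - d) else 0)
            ≤ C₀ * ((2 : ℝ) ^ k₀) ^ (2 - d)) →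
        ∀ (μ : Measure ℂ),
          μ = ∑ m, ENNReal.ofReal (((2 : ℝ) ^ (k m)) ^ (-d)) •
                volume.restrict (square (c m) (2 ^ (k m))) →
        ∀ (x : ℂ) (r : ℝ), 0 < r →
          μ (ball x r) ≤ ENNReal.ofReal (C₄ * r ^ (2 - d)) := by
  refine ⟨36 * C₀ + Real.pi, by positivity, ?_⟩
  rintro M c k hc hdisj hpack μ rfl x r hr
  obtain ⟨n, hn⟩ : ∃ n : ℤ, r ∈ Ioc ((2 : ℝ) ^ n) (2 ^ (n + 1)) :=
    exists_mem_Ioc_zpow hr one_lt_two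
  have hsum_mass : (∑ m, ENNReal.ofReal (((2 : ℝ) ^ (k m)) ^ (-d)) •
        volume.restrict (square (c m) (2 ^ (k m)))) (ball x r) =
      ∑ m, ENNReal.ofReal (((2 : ℝ) ^ (k m)) ^ (-d)) *
        volume (ball x r ∩ square (c m) (2 ^ (k m))) := by
    simp [Measure.finsetSum_apply, Measure.restrict_apply measurableSet_ball]
  rw [hsum_mass]
  refine (Finset.sum_le_sum fun m _ ↦ mass_square_inter_ball_le hd0 (hc m) hr hn.2).trans ?_
  rw [← ENNReal.ofReal_sum_of_nonneg]
  swap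
  · intro m _
    refine add_nonneg (Finset.sum_nonneg fun p _ ↦ ?_) ?_ <;> split_ifs <;> positivity
  refine ENNReal.ofReal_le_ofReal ?_
  rw [Finset.sum_add_distrib, Finset.sum_comm, add_mul]
  refine add_le_add ?_ ?_
  · refine (Finset.sum_le_sum fun p _ ↦
      hpack _ (n + 1) (isDyadicCenter_dyadicCenter _ _ _)).trans ?_
    have hside : ((2 : ℝ) ^ (n + 1)) ^ (2 - d) ≤ 4 * r ^ (2 - d) := by
      calc ((2 : ℝ) ^ (n + 1)) ^ (2 - d) ≤ (2 * r) ^ (2 - d) := by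
            refine Real.rpow_le_rpow (by positivity) ?_ (by linarith)
            rw [zpow_add_one₀ two_ne_zero]
            linarith [hn.1]
        _ = 2 ^ (2 - d) * r ^ (2 - d) := Real.mul_rpow two_pos.le hr.le
        _ ≤ 2 ^ (2 : ℝ) * r ^ (2 - d) := by
            gcongr
            · exact one_le_two
            · linarith
        _ = 4 * r ^ (2 - d) := by norm_num
    have hcard : (Finset.Icc (-1 : ℤ) 1 ×ˢ Finset.Icc (-1 : ℤ) 1).card = 9 := rfl
    rw [Finset.sum_const, hcard, nsmul_eq_mul]
    push_cast
    linarith [mul_le_mul_of_nonneg_left hside (zero_le_one.trans hC₀)]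
  · refine sum_ite_le_of_subsingleton (fun m m' h h' ↦ ?_) (by positivity)
    by_contra hne
    exact (hdisj m m' hne).subset ⟨h, h'⟩
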